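/- Let H ∈ ℝ^p, let M ∈ ℝ^{p×p} be symmetric positive definite, let λ > 0 and let w ∈ ℝ^p have nonnegative entries, let β̂ be the unique minimizer over ℝ^p_+ of −β^T H + (1/2)β^T M β + λ β^T w, and let Ŝ = {s : β̂_s > 0}. Let Σ ∈ ℝ^{p×p} be symmetric positive semidefinite and η ∈ ℝ^p with η^TΣη > 0, set C = (η^TΣη)^{-1}Ση and Z = H − (η^T H)·C, and fix j ∈ {1,…,p} with e_j^T C > 0. Then j ∈ Ŝ if and only if η^T H > (e_j^T C)^{-1}·[e_j^T M β̂_{−j} − e_j^T Z + λ w_j], where β̂_{−j} denotes β̂ with its j-th entry set to zero. -/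

import Mathlib

open Matrix

/-- The normal weighted HSIC-Lasso objective
`f(β) = -βᵀH + (1/2) βᵀMβ + λ βᵀw`. -/
noncomputable def hsicLassoObj {p : ℕ} (H : Fin p → ℝ) (M : Matrix (Fin p) (Fin p) ℝ)
    (lam : ℝ) (w : Fin p → ℝ) (β : Fin p → ℝ) : ℝ :=
  -(β ⬝ᵥ H) + (1 / 2) * (β ⬝ᵥ M.mulVec β) + lam * (β ⬝ᵥ w)

/-- Expansion of the objective along the `j`-th coordinate direction. -/
theorem hsicLassoObj_add_single {p : ℕ} (H : Fin p → ℝ) {M : Matrix (Fin p) (Fin p) ℝ}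
    (hM : M.IsSymm) (lam : ℝ) (w β : Fin p → ℝ) (j : Fin p) (t : ℝ) :
    hsicLassoObj H M lam w (β + Pi.single j t) =
      hsicLassoObj H M lam w β + t * (M.mulVec β j - H j + lam * w j) + t ^ 2 / 2 * M j j := by
  have hsymm : β ⬝ᵥ M.mulVec (Pi.single j t) = t * M.mulVec β j := by
    rw [dotProduct_mulVec, ← mulVec_transpose, hM.eq, dotProduct_single, mul_comm]
  have hdiag : M.mulVec (Pi.single j t) j = M j j * t := by
    simp [mulVec, dotProduct_single]
  simp only [hsicLassoObj, mulVec_add, add_dotProduct, dotProduct_add, single_dotProduct,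
    hsymm, hdiag]
  ring

/-- A minimizer over `t ≥ 0` of `t * g + t ^ 2 / 2 * m`, with `m > 0`, is positive iff `g < 0`. -/
theorem pos_iff_neg_of_forall_quadratic_le {g m t₀ : ℝ} (hm : 0 < m) (ht₀ : 0 ≤ t₀)
    (hmin : ∀ t, 0 ≤ t → t₀ * g + t₀ ^ 2 / 2 * m ≤ t * g + t ^ 2 / 2 * m) :
    0 < t₀ ↔ g < 0 := by
  constructor
  · intro hpos
    have hle := hmin 0 le_rfl
    have hsq : 0 < t₀ ^ 2 / 2 * m := by positivity
    by_contra! hg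
    have := mul_nonneg ht₀ hg
    linarith
  · intro hg
    refine lt_of_le_of_ne ht₀ fun h0 => ?_
    subst h0
    have hle := hmin (-g / m) (div_nonneg (by linarith) hm.le)
    have heq : -g / m * g + (-g / m) ^ 2 / 2 * m = -(g ^ 2 / (2 * m)) := by
      field_simp
      ring
    have hsq : 0 < g ^ 2 / (2 * m) := div_pos (by nlinarith) (by linarith)
    linarith

/-- **Direct truncation bound for the event `{j ∈ Ŝ}`.** With `C = (ηᵀΣη)⁻¹ Ση`,
`Z = H - (ηᵀH)·C` and `eⱼᵀC > 0`, feature `j` is selected (`β̂ j > 0`) iff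
`ηᵀH > (eⱼᵀC)⁻¹ [eⱼᵀ M β̂₋ⱼ - eⱼᵀ Z + λ wⱼ]`. -/
theorem hsicLasso_direct_truncation {p : ℕ} (H : Fin p → ℝ)
    (M : Matrix (Fin p) (Fin p) ℝ) (hM : M.PosDef)
    (lam : ℝ) (hlam : 0 < lam) (w : Fin p → ℝ) (hw : ∀ i, 0 ≤ w i)
    (βh : Fin p → ℝ) (hβh : ∀ i, 0 ≤ βh i)
    (hmin : ∀ β : Fin p → ℝ, (∀ i, 0 ≤ β i) →
      hsicLassoObj H M lam w βh ≤ hsicLassoObj H M lam w β)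
    (Cov : Matrix (Fin p) (Fin p) ℝ) (hCov : Cov.PosSemidef)
    (η : Fin p → ℝ) (hη : 0 < η ⬝ᵥ Cov.mulVec η)
    (C : Fin p → ℝ) (hC : C = (η ⬝ᵥ Cov.mulVec η)⁻¹ • Cov.mulVec η)
    (Z : Fin p → ℝ) (hZ : Z = fun i => H i - (η ⬝ᵥ H) * C i)
    (j : Fin p) (hj : 0 < C j) :
    0 < βh j ↔
      η ⬝ᵥ H > (C j)⁻¹ * (M.mulVec (Function.update βh j 0) j - Z j + lam * w j) := by
  have hsymm : M.IsSymm := by simpa [IsHermitian, IsSymm] using hM.isHermitian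
  have hsplit : Function.update βh j 0 + Pi.single j (βh j) = βh := by
    ext i
    by_cases h : i = j
    · subst h; simp
    · simp [h]
  rw [pos_iff_neg_of_forall_quadratic_le
    (g := M.mulVec (Function.update βh j 0) j - H j + lam * w j) (hM.diag_pos (i := j)) (hβh j)]
  · rw [gt_iff_lt, inv_mul_lt_iff₀ hj, hZ]
    constructor <;> intro h <;> linarith
  · intro t ht
    have h := hmin (Function.update βh j 0 + Pi.single j t) fun i => by
      by_cases h : i = j
      · subst h; simpa using ht
      · simpa [h] using hβh i
    rw [← hsplit, hsicLassoObj_add_single H hsymm] at h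
    simp only [hsplit] at h
    rw [hsicLassoObj_add_single H hsymm] at h
    linarith
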